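/- arXiv:2206.03094 — 2 statements merged into one kernel-verified Lean document; each statement's English description precedes it below -/
import Mathlib

section
/- Let (X,d) be a metric space, μ a locally finite Borel measure on X giving positive measure to every nonempty open ball, and E ⊆ X a μ-measurable set. Assume there is ε > 0 such that ∂_μ E = {x ∈ X : min{μ(E ∩ B(x,r)), μ(Eᶜ ∩ B(x,r))} > ε·μ(B(x,r)) for all r > 0}. Then ∂_μ E = ∂*E. -/
open MeasureTheory Metric Filter Topology Set

/-- Measure-theoretic support of a set: points all of whose balls meet the set in positive
measure. -/
def msSupport {X : Type*} [MetricSpace X] [MeasurableSpace X]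
    (μ : Measure X) (E : Set X) : Set X :=
  {x : X | ∀ r : ℝ, 0 < r → 0 < μ (E ∩ ball x r)}

/-- Measure-theoretic interior of a set: complement of the measure-theoretic support of the
complement. -/
def msInterior {X : Type*} [MetricSpace X] [MeasurableSpace X]
    (μ : Measure X) (E : Set X) : Set X :=
  (msSupport μ Eᶜ)ᶜ

/-- Measure-theoretic boundary of a set. -/
def msBoundary {X : Type*} [MetricSpace X] [MeasurableSpace X]
    (μ : Measure X) (E : Set X) : Set X :=
  msSupport μ E ∩ msSupport μ Eᶜ

/-- The set of density-one points of `E`. -/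
def densityOnePoints {X : Type*} [MetricSpace X] [MeasurableSpace X]
    (μ : Measure X) (E : Set X) : Set X :=
  {x : X | Tendsto (fun r : ℝ => μ (E ∩ ball x r) / μ (ball x r)) (𝓝[>] 0) (𝓝 1)}

/-- The set of density-zero points of `E`. -/
def densityZeroPoints {X : Type*} [MetricSpace X] [MeasurableSpace X]
    (μ : Measure X) (E : Set X) : Set X :=
  {x : X | Tendsto (fun r : ℝ => μ (E ∩ ball x r) / μ (ball x r)) (𝓝[>] 0) (𝓝 0)}

/-- The essential boundary of `E`. -/
def essBoundary {X : Type*} [MetricSpace X] [MeasurableSpace X]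
    (μ : Measure X) (E : Set X) : Set X :=
  (densityZeroPoints μ E ∪ densityOnePoints μ E)ᶜ

/-- Around every point, small balls have finite measure. -/
lemma eventually_measure_ball_lt_top {X : Type*} [MetricSpace X] [MeasurableSpace X]
    (μ : Measure X) [IsLocallyFiniteMeasure μ] (x : X) :
    ∀ᶠ r in 𝓝[>] (0 : ℝ), μ (ball x r) < ⊤ := by
  obtain ⟨s, hs, hμs⟩ := μ.finiteAt_nhds x
  obtain ⟨R, hR, hRs⟩ := Metric.mem_nhds_iff.1 hs
  filter_upwards [Ioo_mem_nhdsGT hR] with r hr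
  exact (measure_mono ((ball_subset_ball hr.2.le).trans hRs)).trans_lt hμs

/-- On small balls, the density ratios of a set and of its complement add up to one. -/
lemma eventually_density_add_density_compl {X : Type*} [MetricSpace X] [MeasurableSpace X]
    [BorelSpace X] (μ : Measure X) [IsLocallyFiniteMeasure μ]
    (hpos : ∀ (x : X) (r : ℝ), 0 < r → 0 < μ (ball x r))
    {E : Set X} (hE : NullMeasurableSet E μ) (x : X) :
    ∀ᶠ r in 𝓝[>] (0 : ℝ),
      μ (E ∩ ball x r) / μ (ball x r) + μ (Eᶜ ∩ ball x r) / μ (ball x r) = 1 := by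
  filter_upwards [eventually_measure_ball_lt_top μ x, self_mem_nhdsWithin] with r hr hr0
  rw [← ENNReal.add_div, inter_comm E, inter_comm Eᶜ, ← sdiff_eq, measure_inter_add_sdiff₀ _ hE,
    ENNReal.div_self (hpos x r hr0).ne' hr.ne]

/-- The density-one points of a set are the density-zero points of its complement. -/
lemma densityOnePoints_eq_densityZeroPoints_compl {X : Type*} [MetricSpace X]
    [MeasurableSpace X] [BorelSpace X] (μ : Measure X) [IsLocallyFiniteMeasure μ]
    (hpos : ∀ (x : X) (r : ℝ), 0 < r → 0 < μ (ball x r))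
    {E : Set X} (hE : NullMeasurableSet E μ) :
    densityOnePoints μ E = densityZeroPoints μ Eᶜ := by
  ext x
  have hsum := eventually_density_add_density_compl μ hpos hE x
  constructor
  · intro h
    have h' := ENNReal.Tendsto.sub (tendsto_const_nhds (x := (1 : ENNReal))) h
      (Or.inl ENNReal.one_ne_top)
    rw [tsub_self] at h'
    refine h'.congr' ?_
    filter_upwards [hsum] with r hr
    rw [← hr]
    exact ENNReal.add_sub_cancel_left
      (ne_top_of_le_ne_top ENNReal.one_ne_top (hr ▸ le_self_add))
  · intro h
    have h' := ENNReal.Tendsto.sub (tendsto_const_nhds (x := (1 : ENNReal))) h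
      (Or.inl ENNReal.one_ne_top)
    rw [tsub_zero] at h'
    refine h'.congr' ?_
    filter_upwards [hsum] with r hr
    rw [← hr]
    exact ENNReal.add_sub_cancel_right
      (ne_top_of_le_ne_top ENNReal.one_ne_top (hr ▸ le_add_self))

/-- Points outside the measure-theoretic support are density-zero points. -/
lemma compl_msSupport_subset_densityZeroPoints {X : Type*} [MetricSpace X] [MeasurableSpace X]
    (μ : Measure X) (E : Set X) : (msSupport μ E)ᶜ ⊆ densityZeroPoints μ E := by
  intro x hx
  simp only [msSupport, mem_compl_iff, mem_ofPred_eq, not_forall, not_lt, nonpos_iff_eq_zero] at hx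
  obtain ⟨R, hR, hR0⟩ := hx
  refine tendsto_const_nhds.congr' ?_
  filter_upwards [Ioo_mem_nhdsGT hR] with r hr
  rw [measure_mono_null (inter_subset_inter_right E (ball_subset_ball hr.2.le)) hR0,
    ENNReal.zero_div]

/-- A uniform positive lower density bound excludes density zero. -/
lemma notMem_densityZeroPoints_of_lower_bound {X : Type*} [MetricSpace X] [MeasurableSpace X]
    (μ : Measure X) [IsLocallyFiniteMeasure μ]
    (hpos : ∀ (x : X) (r : ℝ), 0 < r → 0 < μ (ball x r))
    {E : Set X} {c : ENNReal} (hc : 0 < c) {x : X}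
    (h : ∀ r : ℝ, 0 < r → c * μ (ball x r) ≤ μ (E ∩ ball x r)) :
    x ∉ densityZeroPoints μ E := by
  intro hx
  refine hc.not_ge (ge_of_tendsto hx ?_)
  filter_upwards [eventually_measure_ball_lt_top μ x, self_mem_nhdsWithin] with r hr hr0
  exact (ENNReal.le_div_iff_mul_le (Or.inl (hpos x r hr0).ne') (Or.inl hr.ne)).2 (h r hr0)

/-- Under the uniform lower density bound on the measure-theoretic boundary, the
measure-theoretic boundary coincides with the essential boundary. -/
theorem msBoundary_eq_essBoundary
    {X : Type*} [MetricSpace X] [MeasurableSpace X] [BorelSpace X]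
    (μ : Measure X) [IsLocallyFiniteMeasure μ]
    (hpos : ∀ (x : X) (r : ℝ), 0 < r → 0 < μ (ball x r))
    (E : Set X) (hE : NullMeasurableSet E μ)
    (ε : NNReal) (hε : 0 < ε)
    (hbd : msBoundary μ E = {x : X | ∀ r : ℝ, 0 < r →
      (ε : ENNReal) * μ (ball x r) < min (μ (E ∩ ball x r)) (μ (Eᶜ ∩ ball x r))}) :
    msBoundary μ E = essBoundary μ E := by
  rw [essBoundary, densityOnePoints_eq_densityZeroPoints_compl μ hpos hE]
  have hc : (0 : ENNReal) < ε := ENNReal.coe_pos.2 hε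
  refine Subset.antisymm (fun x hx => ?_) (fun x hx => ?_)
  · rw [hbd] at hx
    rintro (h | h)
    · exact notMem_densityZeroPoints_of_lower_bound μ hpos hc
        (fun r hr => (lt_min_iff.1 (hx r hr)).1.le) h
    · exact notMem_densityZeroPoints_of_lower_bound μ hpos hc
        (fun r hr => (lt_min_iff.1 (hx r hr)).2.le) h
  · rw [compl_union] at hx
    exact ⟨not_not.1 fun h => hx.1 (compl_msSupport_subset_densityZeroPoints μ E h),
      not_not.1 fun h => hx.2 (compl_msSupport_subset_densityZeroPoints μ Eᶜ h)⟩
end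

section
/- Let (X,d) be a separable metric space and μ a nonzero locally finite Borel measure on X giving positive measure to every nonempty open ball and which is doubling: there is C > 0 with μ(B(x,2r)) ≤ C·μ(B(x,r)) for all x ∈ X and r > 0. Let E ⊆ X be a μ-measurable set and assume there is ε > 0 such that ∂_μ E = {x ∈ X : min{μ(E ∩ B(x,r)), μ(Eᶜ ∩ B(x,r))} > ε·μ(B(x,r)) for all r > 0}. Then the closure of Int_μ(E) equals spt_μ(E), and the topological interior of spt_μ(E) equals Int_μ(E). -/
open MeasureTheory Metric Filter Topology Set

section MeasureTheoreticSupport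

variable {X : Type*} [MetricSpace X] [MeasurableSpace X] {μ : Measure X} {E : Set X}

theorem isClosed_msSupport (μ : Measure X) (E : Set X) : IsClosed (msSupport μ E) := by
  refine isClosed_of_closure_subset fun x hx r hr => ?_
  obtain ⟨y, hy, hxy⟩ := Metric.mem_closure_iff.1 hx (r / 2) (half_pos hr)
  refine (hy (r / 2) (half_pos hr)).trans_le
    (measure_mono (inter_subset_inter_right E (ball_subset_ball' ?_)))
  rw [dist_comm]
  linarith

theorem msInterior_compl (μ : Measure X) (E : Set X) :
    msInterior μ Eᶜ = (msSupport μ E)ᶜ := by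
  rw [msInterior, compl_compl]

theorem msInterior_subset_msSupport (hpos : ∀ (x : X) (r : ℝ), 0 < r → 0 < μ (ball x r)) :
    msInterior μ E ⊆ msSupport μ E := by
  intro x hx r hr
  simp only [msInterior, msSupport, mem_compl_iff, mem_ofPred_eq, not_forall, not_lt,
    nonpos_iff_eq_zero] at hx
  obtain ⟨s, hs, hzero⟩ := hx
  have hball : ball x (min r s) ⊆ (E ∩ ball x r) ∪ (Eᶜ ∩ ball x s) := by
    intro y hy
    by_cases hyE : y ∈ E
    · exact Or.inl ⟨hyE, ball_subset_ball (min_le_left r s) hy⟩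
    · exact Or.inr ⟨hyE, ball_subset_ball (min_le_right r s) hy⟩
  calc 0 < μ (ball x (min r s)) := hpos x _ (lt_min hr hs)
    _ ≤ μ (E ∩ ball x r) + μ (Eᶜ ∩ ball x s) := (measure_mono hball).trans (measure_union_le _ _)
    _ = μ (E ∩ ball x r) := by rw [hzero, add_zero]

theorem measure_closedBall_le_mul_measure_ball {C : NNReal}
    (hdoub : ∀ (x : X) (r : ℝ), 0 < r → μ (ball x (2 * r)) ≤ (C : ENNReal) * μ (ball x r))
    (x : X) {r : ℝ} (hr : 0 < r) : μ (closedBall x r) ≤ (C : ENNReal) * μ (ball x r) :=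
  (measure_mono (closedBall_subset_ball (by linarith))).trans (hdoub x r hr)

theorem isUnifLocDoublingMeasure_of_measure_ball_le {C : NNReal}
    (hdoub : ∀ (x : X) (r : ℝ), 0 < r → μ (ball x (2 * r)) ≤ (C : ENNReal) * μ (ball x r)) :
    IsUnifLocDoublingMeasure μ := by
  refine ⟨C * C, ?_⟩
  filter_upwards [self_mem_nhdsWithin] with r (hr : 0 < r) x
  calc μ (closedBall x (2 * r)) ≤ C * μ (ball x (2 * r)) :=
        measure_closedBall_le_mul_measure_ball hdoub x (by positivity)
    _ ≤ C * (C * μ (closedBall x r)) := by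
        gcongr
        exact (hdoub x r hr).trans (mul_le_mul_right (measure_mono ball_subset_closedBall) _)
    _ = (C * C : NNReal) * μ (closedBall x r) := by
        rw [ENNReal.coe_mul, mul_assoc]

theorem mem_msSupport_of_tendsto_closedBall {x : X}
    (hx : Tendsto (fun r : ℝ => μ (E ∩ closedBall x r) / μ (closedBall x r)) (𝓝[>] 0) (𝓝 1)) :
    x ∈ msSupport μ E := by
  intro r hr
  by_contra hzero
  rw [not_lt, nonpos_iff_eq_zero] at hzero
  refine one_ne_zero (tendsto_nhds_unique hx (tendsto_const_nhds.congr' ?_))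
  filter_upwards [Ioo_mem_nhdsGT hr] with s hs
  rw [measure_mono_null (inter_subset_inter_right E (closedBall_subset_ball hs.2)) hzero,
    ENNReal.zero_div]

theorem not_forall_mul_measure_ball_le_of_tendsto_closedBall [OpensMeasurableSpace X]
    [IsLocallyFiniteMeasure μ]
    (hpos : ∀ (x : X) (r : ℝ), 0 < r → 0 < μ (ball x r)) {C : NNReal}
    (hdoub : ∀ (x : X) (r : ℝ), 0 < r → μ (ball x (2 * r)) ≤ (C : ENNReal) * μ (ball x r))
    (hE : NullMeasurableSet E μ) {ε : NNReal} (hε : 0 < ε) {x : X}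
    (hx : Tendsto (fun r : ℝ => μ (E ∩ closedBall x r) / μ (closedBall x r)) (𝓝[>] 0) (𝓝 1)) :
    ¬ ∀ r : ℝ, 0 < r → (ε : ENNReal) * μ (ball x r) ≤ μ (Eᶜ ∩ ball x r) := by
  intro h
  obtain ⟨R, hR, hfin⟩ := (μ.finiteAt_nhds x).exists_mem_basis nhds_basis_closedBall
  have hlim : Tendsto (fun r : ℝ => (C : ENNReal) * (μ (E ∩ closedBall x r) / μ (closedBall x r))
      + ε) (𝓝[>] 0) (𝓝 ((C : ENNReal) * 1 + ε)) :=
    (ENNReal.Tendsto.const_mul hx (Or.inr ENNReal.coe_ne_top)).add_const _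
  have hle : (C : ENNReal) * 1 + ε ≤ C := by
    refine le_of_tendsto hlim ?_
    filter_upwards [Ioo_mem_nhdsGT hR] with r hr
    have hne : μ (closedBall x r) ≠ 0 :=
      ((hpos x r hr.1).trans_le (measure_mono ball_subset_closedBall)).ne'
    have htop : μ (closedBall x r) ≠ ⊤ :=
      ((measure_mono (closedBall_subset_closedBall hr.2.le)).trans_lt hfin).ne
    have hcompl : (ε : ENNReal) * μ (closedBall x r) ≤ C * μ (Eᶜ ∩ closedBall x r) :=
      calc (ε : ENNReal) * μ (closedBall x r) ≤ ε * (C * μ (ball x r)) := by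
            gcongr
            exact measure_closedBall_le_mul_measure_ball hdoub x hr.1
        _ = C * (ε * μ (ball x r)) := by ring
        _ ≤ C * μ (Eᶜ ∩ closedBall x r) := by
            gcongr
            exact (h r hr.1).trans
              (measure_mono (inter_subset_inter_right _ ball_subset_closedBall))
    rw [← ENNReal.mul_le_mul_iff_left hne htop, add_mul, mul_assoc,
      ENNReal.div_mul_cancel hne htop]
    calc (C : ENNReal) * μ (E ∩ closedBall x r) + ε * μ (closedBall x r)
        ≤ C * μ (E ∩ closedBall x r) + C * μ (Eᶜ ∩ closedBall x r) := by gcongr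
      _ = C * μ (closedBall x r) := by
          rw [← mul_add, inter_comm E, inter_comm Eᶜ, ← sdiff_eq,
            measure_inter_add_sdiff₀ _ hE]
  rw [mul_one] at hle
  norm_cast at hle
  exact hle.not_gt (lt_add_of_pos_right C hε)

theorem closure_msInterior_eq_msSupport [TopologicalSpace.SeparableSpace X] [BorelSpace X]
    [IsLocallyFiniteMeasure μ]
    (hpos : ∀ (x : X) (r : ℝ), 0 < r → 0 < μ (ball x r)) {C : NNReal}
    (hdoub : ∀ (x : X) (r : ℝ), 0 < r → μ (ball x (2 * r)) ≤ (C : ENNReal) * μ (ball x r))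
    (hE : NullMeasurableSet E μ) {ε : NNReal} (hε : 0 < ε)
    (hbd : ∀ x ∈ msBoundary μ E, ∀ r : ℝ, 0 < r →
      (ε : ENNReal) * μ (ball x r) ≤ μ (Eᶜ ∩ ball x r)) :
    closure (msInterior μ E) = msSupport μ E := by
  refine (closure_minimal (msInterior_subset_msSupport hpos)
    (isClosed_msSupport μ E)).antisymm fun x hx => Metric.mem_closure_iff.2 fun r hr => ?_
  have := UniformSpace.secondCountable_of_separable X
  have := isUnifLocDoublingMeasure_of_measure_ball_le hdoub
  have hball : μ.restrict E (ball x r) ≠ 0 := by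
    rw [Measure.restrict_apply measurableSet_ball, inter_comm]
    exact (hx r hr).ne'
  obtain ⟨y, hy, hdens⟩ := ((frequently_ae_mem_iff.2 hball).and_eventually
    (IsUnifLocDoublingMeasure.ae_tendsto_measure_inter_div μ E 0)).exists
  have hlim : Tendsto (fun r : ℝ => μ (E ∩ closedBall y r) / μ (closedBall y r))
      (𝓝[>] 0) (𝓝 1) := hdens (fun _ => y) (fun s => s) tendsto_id (by simp)
  refine ⟨y, fun hyc => ?_, mem_ball'.1 hy⟩
  exact not_forall_mul_measure_ball_le_of_tendsto_closedBall hpos hdoub hE hε hlim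
    (hbd y ⟨mem_msSupport_of_tendsto_closedBall hlim, hyc⟩)

end MeasureTheoreticSupport

/-- Under the uniform lower density bound on the measure-theoretic boundary of a set in a
doubling metric measure space, the closure of the measure-theoretic interior is the
measure-theoretic support, and the topological interior of the measure-theoretic support is
the measure-theoretic interior. -/
theorem closure_msInterior_and_interior_msSupport
    {X : Type*} [MetricSpace X] [TopologicalSpace.SeparableSpace X]
    [MeasurableSpace X] [BorelSpace X]
    (μ : Measure X) [IsLocallyFiniteMeasure μ] (hμ : μ ≠ 0)
    (hpos : ∀ (x : X) (r : ℝ), 0 < r → 0 < μ (ball x r))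
    (C : NNReal) (hC : 0 < C)
    (hdoub : ∀ (x : X) (r : ℝ), 0 < r →
      μ (ball x (2 * r)) ≤ (C : ENNReal) * μ (ball x r))
    (E : Set X) (hE : NullMeasurableSet E μ)
    (ε : NNReal) (hε : 0 < ε)
    (hbd : msBoundary μ E = {x : X | ∀ r : ℝ, 0 < r →
      (ε : ENNReal) * μ (ball x r) < min (μ (E ∩ ball x r)) (μ (Eᶜ ∩ ball x r))}) :
    closure (msInterior μ E) = msSupport μ E ∧
    interior (msSupport μ E) = msInterior μ E := by
  have hlower : ∀ x ∈ msBoundary μ E, ∀ r : ℝ, 0 < r →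
      (ε : ENNReal) * μ (ball x r) < min (μ (E ∩ ball x r)) (μ (Eᶜ ∩ ball x r)) :=
    fun x hx => hbd.subset hx
  refine ⟨closure_msInterior_eq_msSupport hpos hdoub hE hε fun x hx r hr =>
    (lt_min_iff.1 (hlower x hx r hr)).2.le, ?_⟩
  have hcompl : closure (msInterior μ Eᶜ) = msSupport μ Eᶜ := by
    refine closure_msInterior_eq_msSupport hpos hdoub hE.compl hε fun x hx r hr => ?_
    rw [msBoundary, compl_compl, inter_comm] at hx
    rw [compl_compl]
    exact (lt_min_iff.1 (hlower x hx r hr)).1.le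
  rw [interior_eq_compl_closure_compl, ← msInterior_compl, hcompl, msInterior]
end
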